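/- arXiv:1001.0377 — 3 statements merged into one kernel-verified Lean document; each statement's English description precedes it below -/
import Mathlib

section
/- Let p > 1 and q > 0 and let sin_{pq} : [0, π_{pq}/2] → [0,1] denote the inverse of arcsin_{pq}. Then sin_{pq} is differentiable on the open interval (0, π_{pq}/2) and its derivative there equals cos_{pq}(t) := (1 − sin_{pq}(t)^q)^{1/p}; in particular cos_{pq}(t)^p + sin_{pq}(t)^q = 1 for all t ∈ (0, π_{pq}/2). -/
open Real Set Filter MeasureTheory

/-- Generalized arcsine: `arcsin_{pq}(σ) = ∫_0^σ (1 - s^q)^(-1/p) ds`. -/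
noncomputable def arcsinPQ (p q σ : ℝ) : ℝ :=
  ∫ s in (0:ℝ)..σ, (1 - s ^ q) ^ (-(1 / p))

/-- The generalized half-period `π_{pq} = 2 arcsin_{pq}(1)`. -/
noncomputable def piPQ (p q : ℝ) : ℝ := 2 * arcsinPQ p q 1

/-- Generalized incomplete elliptic integral:
`arcsn_{pq}(σ,k) = ∫_0^σ ((1-s^q)(1-k^q s^q))^(-1/p) ds`. -/
noncomputable def arcsnPQ (p q k σ : ℝ) : ℝ :=
  ∫ s in (0:ℝ)..σ, ((1 - s ^ q) * (1 - k ^ q * s ^ q)) ^ (-(1 / p))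

/-- Generalized complete elliptic integral `K_{pq}(k) = arcsn_{pq}(1,k)`. -/
noncomputable def Kpq (p q k : ℝ) : ℝ := arcsnPQ p q k 1

/-- `φ_m(s) = |s|^(m-2) s` for `s ≠ 0`, `φ_m(0) = 0`. -/
noncomputable def phi (m s : ℝ) : ℝ := if s = 0 then 0 else |s| ^ (m - 2) * s

/-- Incomplete beta function `B̃(a,b,u) = ∫_0^u z^(a-1) (1-z)^(b-1) dz`. -/
noncomputable def incBeta (a b u : ℝ) : ℝ :=
  ∫ z in (0:ℝ)..u, z ^ (a - 1) * (1 - z) ^ (b - 1)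

/-- A classical solution of `(φ_p(u'))' + λ φ_q(u) = 0` on `(0,T)` with
`u(0) = u(T) = 0`: `u ∈ C¹([0,T])`, `t ↦ φ_p(u'(t))` is differentiable on `(0,T)`
and the equation holds at every point of `(0,T)`. -/
def IsSolE (p q T lam : ℝ) (u : ℝ → ℝ) : Prop :=
  ∃ u' : ℝ → ℝ,
    (∀ t ∈ Set.Icc 0 T, HasDerivWithinAt u (u' t) (Set.Icc 0 T) t) ∧
    ContinuousOn u' (Set.Icc 0 T) ∧
    (∀ t ∈ Set.Ioo 0 T, HasDerivWithinAt (fun s => phi p (u' s))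
      (-(lam * phi q (u t))) (Set.Ioo 0 T) t) ∧
    u 0 = 0 ∧ u T = 0

/-- A classical solution of `(φ_p(u'))' + λ φ_q(u)(1 - |u|^q) = 0` on `(0,T)` with
`u(0) = u(T) = 0`. -/
def IsSolP (p q T lam : ℝ) (u : ℝ → ℝ) : Prop :=
  ∃ u' : ℝ → ℝ,
    (∀ t ∈ Set.Icc 0 T, HasDerivWithinAt u (u' t) (Set.Icc 0 T) t) ∧
    ContinuousOn u' (Set.Icc 0 T) ∧
    (∀ t ∈ Set.Ioo 0 T, HasDerivWithinAt (fun s => phi p (u' s))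
      (-(lam * phi q (u t) * (1 - |u t| ^ q))) (Set.Ioo 0 T) t) ∧
    u 0 = 0 ∧ u T = 0

/-- `Φ(k) = (1+k^q)^(1/p) (2k^q/(1+k^q))^(1/q - 1/p) K_{pq}(k)`. -/
noncomputable def PhiFun (p q k : ℝ) : ℝ :=
  (1 + k ^ q) ^ (1 / p) * (2 * k ^ q / (1 + k ^ q)) ^ (1 / q - 1 / p) * Kpq p q k

/-- Bernoulli-type lower bound for `1 - s ^ q` on the unit interval. -/
lemma min_one_mul_one_sub_le_one_sub_rpow {q s : ℝ} (hq : 0 < q) (hs0 : 0 ≤ s) (hs1 : s ≤ 1) :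
    min 1 q * (1 - s) ≤ 1 - s ^ q := by
  rcases le_total 1 q with h | h
  · rw [min_eq_left h]
    have := Real.rpow_le_rpow_of_exponent_ge' hs0 hs1 zero_le_one h
    rw [Real.rpow_one] at this
    linarith
  · rw [min_eq_right h]
    have := rpow_one_add_le_one_add_mul_self (s := s - 1) (by linarith) hq.le h
    rw [add_sub_cancel] at this
    linarith

lemma intervalIntegrable_one_sub_rpow_rpow {p q : ℝ} (hp : 1 < p) (hq : 0 < q) :
    IntervalIntegrable (fun s : ℝ => (1 - s ^ q) ^ (-(1 / p))) volume 0 1 := by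
  have hexp : -(1 / p) ≤ 0 := by
    have : 0 < 1 / p := by positivity
    linarith
  have hc : 0 < min 1 q := lt_min one_pos hq
  have hdom : IntervalIntegrable
      (fun s : ℝ => (min 1 q) ^ (-(1 / p)) * (1 - s) ^ (-(1 / p))) volume 0 1 := by
    refine IntervalIntegrable.const_mul ?_ _
    have h : IntervalIntegrable (fun s : ℝ => s ^ (-(1 / p))) volume 1 0 := by
      refine intervalIntegral.intervalIntegrable_rpow' ?_
      have : 1 / p < 1 := by rw [div_lt_one (by linarith)]; exact hp
      linarith
    simpa using h.comp_sub_left 1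
  refine hdom.mono_fun (Measurable.aestronglyMeasurable (by fun_prop)) ?_
  rw [uIoc_of_le zero_le_one, EventuallyLE, ae_restrict_iff' measurableSet_Ioc]
  filter_upwards [Measure.ae_ne volume (1 : ℝ)] with s hs1 hs
  have hlt : 0 < 1 - s := sub_pos.2 (lt_of_le_of_ne hs.2 hs1)
  have hle := min_one_mul_one_sub_le_one_sub_rpow hq hs.1.le hs.2
  have hpos : 0 < 1 - s ^ q := (mul_pos hc hlt).trans_le hle
  rw [Real.norm_of_nonneg (by positivity), Real.norm_of_nonneg (by positivity),
    ← Real.mul_rpow hc.le hlt.le]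
  exact Real.rpow_le_rpow_of_nonpos (mul_pos hc hlt) hle hexp

lemma continuousOn_arcsinPQ {p q : ℝ} (hp : 1 < p) (hq : 0 < q) :
    ContinuousOn (arcsinPQ p q) (Icc 0 1) := by
  have h := intervalIntegral.continuousOn_primitive_interval'
    (intervalIntegrable_one_sub_rpow_rpow hp hq) left_mem_uIcc
  rwa [uIcc_of_le zero_le_one] at h

lemma hasStrictDerivAt_arcsinPQ {p q σ : ℝ} (hp : 1 < p) (hq : 0 < q) (hσ : σ ∈ Ioo (0 : ℝ) 1) :
    HasStrictDerivAt (arcsinPQ p q) ((1 - σ ^ q) ^ (-(1 / p))) σ := by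
  have hpos : 0 < 1 - σ ^ q := sub_pos.2 (Real.rpow_lt_one hσ.1.le hσ.2 hq)
  refine intervalIntegral.integral_hasStrictDerivAt_right ?_ ?_ ?_
  · refine (intervalIntegrable_one_sub_rpow_rpow hp hq).mono_set ?_
    rw [uIcc_of_le hσ.1.le, uIcc_of_le zero_le_one]
    exact Icc_subset_Icc_right hσ.2.le
  · exact (Measurable.stronglyMeasurable (by fun_prop)).stronglyMeasurableAtFilter
  · exact (continuousAt_const.sub (Real.continuousAt_rpow_const _ _ (Or.inl hσ.1.ne'))).rpow_const
      (Or.inl hpos.ne')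

theorem stmt2 (p q : ℝ) (hp : 1 < p) (hq : 0 < q)
    (sinpq : ℝ → ℝ)
    (hinv : ∀ σ ∈ Icc (0:ℝ) 1, sinpq (arcsinPQ p q σ) = σ) :
    ∀ t ∈ Ioo 0 (piPQ p q / 2),
      HasDerivAt sinpq ((1 - sinpq t ^ q) ^ (1 / p)) t ∧
      ((1 - sinpq t ^ q) ^ (1 / p)) ^ p + sinpq t ^ q = 1 := by
  intro t ht
  have h0 : arcsinPQ p q 0 = 0 := intervalIntegral.integral_same
  have h1 : piPQ p q / 2 = arcsinPQ p q 1 := by unfold piPQ; ring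
  rw [h1, ← h0] at ht
  obtain ⟨σ, hσ, rfl⟩ := intermediate_value_Ioo zero_le_one (continuousOn_arcsinPQ hp hq) ht
  have hpos : 0 < 1 - σ ^ q := sub_pos.2 (Real.rpow_lt_one hσ.1.le hσ.2 hq)
  rw [hinv σ (Ioo_subset_Icc_self hσ)]
  constructor
  · have hd := (hasStrictDerivAt_arcsinPQ hp hq hσ).to_local_left_inverse (g := sinpq)
      (Real.rpow_pos_of_pos hpos _).ne' (by
        filter_upwards [Icc_mem_nhds hσ.1 hσ.2] with x hx using hinv x hx)
    rw [Real.rpow_neg hpos.le, inv_inv] at hd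
    exact hd.hasDerivAt
  · rw [← Real.rpow_mul hpos.le, one_div_mul_cancel (by linarith), Real.rpow_one]
    ring
end

section
/- Let p > 2 and q > 0. Then the limit as k → 1− of 2·K_{pq}(k) = 2∫_0^1 ((1−s^q)(1−k^q s^q))^{−1/p} ds exists and equals π_{p/2,q} = 2∫_0^1 (1−s^q)^{−2/p} ds, which is finite. -/
open Real Set Filter MeasureTheory

theorem min_mul_one_sub_le_one_sub_rpow {q s : ℝ} (hq : 0 < q) (hs0 : 0 ≤ s) (hs1 : s ≤ 1) :
    min q 1 * (1 - s) ≤ 1 - s ^ q := by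
  rcases le_total q 1 with h | h
  · have hb := rpow_one_add_le_one_add_mul_self (s := s - 1) (by linarith) hq.le h
    rw [add_sub_cancel] at hb
    rw [min_eq_left h]
    linarith
  · have hb := rpow_le_rpow_of_exponent_ge_of_imp hs0 hs1 h (by intros; linarith)
    rw [rpow_one] at hb
    rw [min_eq_right h]
    linarith

theorem intervalIntegrable_one_sub_rpow_rpow_neg {q a : ℝ} (hq : 0 < q) (ha0 : 0 ≤ a)
    (ha1 : a < 1) :
    IntervalIntegrable (fun s : ℝ => (1 - s ^ q) ^ (-a)) volume 0 1 := by
  have hm : 0 < min q 1 := lt_min hq one_pos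
  have hdom : IntervalIntegrable (fun s : ℝ => (min q 1) ^ (-a) * (1 - s) ^ (-a)) volume 0 1 := by
    have h := (intervalIntegral.intervalIntegrable_rpow' (a := 0) (b := 1)
      (r := -a) (by linarith)).comp_sub_left 1
    simpa using (h.symm.const_mul ((min q 1) ^ (-a)))
  refine hdom.mono_fun (Measurable.aestronglyMeasurable (by fun_prop)) ?_
  rw [uIoc_of_le zero_le_one, ← restrict_Ioo_eq_restrict_Ioc]
  refine (ae_restrict_iff' measurableSet_Ioo).2 (.of_forall fun s hs => ?_)
  have h1 : 0 < 1 - s := by linarith [hs.2]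
  have hle := min_mul_one_sub_le_one_sub_rpow hq hs.1.le hs.2.le
  have hpos : 0 < 1 - s ^ q := (mul_pos hm h1).trans_le hle
  beta_reduce
  rw [norm_of_nonneg (by positivity), norm_of_nonneg (by positivity),
    ← mul_rpow hm.le h1.le]
  exact rpow_le_rpow_of_nonpos (mul_pos hm h1) hle (by linarith)

theorem mul_self_rpow_neg_one_div {x : ℝ} (hx : 0 ≤ x) (p : ℝ) :
    (x * x) ^ (-(1 / p)) = x ^ (-(1 / (p / 2))) := by
  rw [← sq, ← rpow_natCast, ← rpow_mul hx]
  congr 1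
  rw [one_div_div]
  push_cast
  ring

theorem stmt5 (p q : ℝ) (hp : 2 < p) (hq : 0 < q) :
    IntervalIntegrable (fun s : ℝ => (1 - s ^ q) ^ (-(1 / (p / 2)))) volume 0 1 ∧
    Tendsto (fun k => 2 * Kpq p q k) (nhdsWithin 1 (Iio 1)) (nhds (piPQ (p / 2) q)) := by
  have hint : IntervalIntegrable (fun s : ℝ => (1 - s ^ q) ^ (-(1 / (p / 2)))) volume 0 1 := by
    refine intervalIntegrable_one_sub_rpow_rpow_neg hq (by positivity) ?_
    rw [div_lt_one (by positivity)]
    linarith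
  refine ⟨hint, Tendsto.const_mul 2 ?_⟩
  have hae : ∀ᵐ s : ℝ, s ≠ 1 := by simp [ae_iff]
  refine intervalIntegral.tendsto_integral_filter_of_dominated_convergence _
    (.of_forall fun k => Measurable.aestronglyMeasurable (by fun_prop)) ?_ hint ?_
  · filter_upwards [Ioo_mem_nhdsLT (zero_lt_one' ℝ)] with k hk
    filter_upwards [hae] with s hs hmem
    rw [uIoc_of_le zero_le_one] at hmem
    have hsq : s ^ q < 1 := rpow_lt_one hmem.1.le (hmem.2.lt_of_ne hs) hq
    have hx : 0 < 1 - s ^ q := by linarith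
    have hkq : k ^ q * s ^ q ≤ s ^ q :=
      mul_le_of_le_one_left (rpow_nonneg hmem.1.le q) (rpow_le_one hk.1.le hk.2.le hq.le)
    have hy : 0 ≤ 1 - k ^ q * s ^ q := by linarith
    rw [norm_of_nonneg (by positivity), ← mul_self_rpow_neg_one_div hx.le]
    refine rpow_le_rpow_of_nonpos (mul_pos hx hx) ?_ ?_
    · gcongr
    · rw [neg_nonpos]
      positivity
  · filter_upwards [hae] with s hs hmem
    rw [uIoc_of_le zero_le_one] at hmem
    have hsq : s ^ q < 1 := rpow_lt_one hmem.1.le (hmem.2.lt_of_ne hs) hq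
    have hx : 0 < 1 - s ^ q := by linarith
    rw [← mul_self_rpow_neg_one_div hx.le]
    refine Tendsto.rpow_const ?_ (.inl (mul_pos hx hx).ne')
    have hk : Tendsto (fun k : ℝ => k ^ q) (nhdsWithin 1 (Iio 1)) (nhds 1) := by
      simpa using (continuousAt_rpow_const 1 q (.inl one_ne_zero)).tendsto.mono_left
        nhdsWithin_le_nhds
    simpa using ((hk.mul_const (s ^ q)).const_sub 1).const_mul (1 - s ^ q)
end

section
/- Let p > 1, q > 1 and k ∈ [0,1), and let sn_{pq}(·,k) : ℝ → ℝ be the extended generalized Jacobian elliptic function. Then u(t) = sn_{pq}(t,k) satisfies the equation (φ_p(u'))' + (q/p*)·φ_q(u)·(1 + k^q − 2k^q|u|^q) = 0 at every point of ℝ in the classical sense; that is, u is differentiable on ℝ, t ↦ φ_p(u'(t)) is differentiable on ℝ (including at the points t = nK_{pq}(k), n ∈ ℤ), and its derivative equals −(q/p*)·φ_q(u(t))·(1 + k^q − 2k^q|u(t)|^q) for every t ∈ ℝ. -/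
open Real Set Filter MeasureTheory

open scoped Topology

lemma phi_eq (m s : ℝ) : phi m s = |s| ^ (m - 2) * s := by
  unfold phi
  split_ifs with h <;> simp [h]

lemma phi_neg (m s : ℝ) : phi m (-s) = -phi m s := by
  simp [phi_eq]

lemma phi_of_pos (m : ℝ) {s : ℝ} (hs : 0 < s) : phi m s = s ^ (m - 1) := by
  rw [phi_eq, abs_of_pos hs, ← rpow_add_one hs.ne']
  ring_nf

lemma hasDerivAt_abs_rpow_phi {m : ℝ} (hm : 1 < m) (s : ℝ) :
    HasDerivAt (fun x : ℝ => |x| ^ m) (m * phi m s) s := by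
  rw [phi_eq, ← mul_assoc]
  exact hasDerivAt_abs_rpow s hm

lemma continuous_phi {m : ℝ} (hm : 1 < m) : Continuous (phi m) := by
  have hC : Continuous (deriv fun x : ℝ => |x| ^ m) :=
    (contDiff_norm_rpow (E := ℝ) hm).continuous_deriv le_rfl
  have hd : deriv (fun x : ℝ => |x| ^ m) = fun s => m * phi m s :=
    funext fun s => (hasDerivAt_abs_rpow_phi hm s).deriv
  rw [hd] at hC
  have hm0 : m ≠ 0 := by positivity
  simpa [hm0] using hC.const_mul m⁻¹

/-- A function that is continuous at a point and whose derivative has a limit there is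
differentiable at that point. -/
lemma hasDerivAt_of_tendsto_deriv_nhdsNE {f : ℝ → ℝ} {x e : ℝ}
    (hd : ∀ᶠ y in 𝓝[≠] x, DifferentiableAt ℝ f y) (hf : ContinuousAt f x)
    (he : Tendsto (deriv f) (𝓝[≠] x) (𝓝 e)) : HasDerivAt f e x := by
  have hs : {y | DifferentiableAt ℝ f y} ∈ 𝓝[≠] x := hd
  have hR := hasDerivWithinAt_Ici_of_tendsto_deriv (s := {y | DifferentiableAt ℝ f y})
    (fun y hy => DifferentiableAt.differentiableWithinAt hy) hf.continuousWithinAt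
    (nhdsGT_le_nhdsNE x hs) (he.mono_left (nhdsGT_le_nhdsNE x))
  have hL := hasDerivWithinAt_Iic_of_tendsto_deriv (s := {y | DifferentiableAt ℝ f y})
    (fun y hy => DifferentiableAt.differentiableWithinAt hy) hf.continuousWithinAt
    (nhdsLT_le_nhdsNE x hs) (he.mono_left (nhdsLT_le_nhdsNE x))
  simpa using hL.union hR

/-- Even extension of `s ↦ (1-s^q)(1-k^q s^q)`. -/
noncomputable def snWeight (q k s : ℝ) : ℝ := (1 - |s| ^ q) * (1 - k ^ q * |s| ^ q)

lemma snWeight_neg (q k s : ℝ) : snWeight q k (-s) = snWeight q k s := by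
  simp [snWeight]

lemma hasDerivAt_snWeight {q : ℝ} (hq : 1 < q) (k s : ℝ) :
    HasDerivAt (snWeight q k) (-(q * phi q s * (1 + k ^ q - 2 * k ^ q * |s| ^ q))) s := by
  have h := hasDerivAt_abs_rpow_phi hq s
  exact ((h.const_sub 1).mul ((h.const_mul (k ^ q)).const_sub 1)).congr_deriv (by ring)

lemma continuous_snWeight {q : ℝ} (hq : 1 < q) (k : ℝ) : Continuous (snWeight q k) :=
  continuous_iff_continuousAt.2 fun s => (hasDerivAt_snWeight hq k s).continuousAt

lemma le_snWeight {q k s : ℝ} (hq : 1 < q) (hk : k ∈ Ico (0:ℝ) 1) (hs : |s| ≤ 1) :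
    (1 - |s|) * (1 - k ^ q) ≤ snWeight q k s := by
  have h1 : |s| ^ q ≤ |s| := rpow_le_self_of_le_one (abs_nonneg s) hs hq.le
  have hk0 : 0 ≤ k ^ q := rpow_nonneg hk.1 q
  have hk1 : k ^ q ≤ 1 := rpow_le_one hk.1 hk.2.le (by linarith)
  have h2 : k ^ q * |s| ^ q ≤ k ^ q := mul_le_of_le_one_right hk0 (h1.trans hs)
  unfold snWeight
  apply mul_le_mul <;> linarith

lemma snWeight_pos {q k s : ℝ} (hq : 1 < q) (hk : k ∈ Ico (0:ℝ) 1) (hs : |s| < 1) :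
    0 < snWeight q k s := by
  have hk1 : k ^ q < 1 := rpow_lt_one hk.1 hk.2 (by linarith)
  exact (mul_pos (by linarith) (by linarith)).trans_le (le_snWeight hq hk hs.le)

lemma intervalIntegrable_snWeight {p q k : ℝ} (hp : 1 < p) (hq : 1 < q)
    (hk : k ∈ Ico (0:ℝ) 1) :
    IntervalIntegrable (fun s => snWeight q k s ^ (-(1 / p))) volume (-1) 1 := by
  have hmeas : Measurable (fun s => snWeight q k s ^ (-(1 / p))) :=
    (continuous_snWeight hq k).measurable.pow_const _
  have hp1 : 1 / p < 1 := by rw [div_lt_one (by linarith)]; exact hp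
  have hp0 : 0 ≤ 1 / p := by positivity
  have hk1 : k ^ q < 1 := rpow_lt_one hk.1 hk.2 (by linarith)
  have h0 : IntervalIntegrable (fun s => snWeight q k s ^ (-(1 / p))) volume 0 1 := by
    have hI : IntervalIntegrable (fun x : ℝ => x ^ (-(1 / p))) volume 1 0 :=
      intervalIntegral.intervalIntegrable_rpow' (by linarith)
    have hI' : IntervalIntegrable (fun x : ℝ => (1 - x) ^ (-(1 / p))) volume 0 1 := by
      simpa using hI.comp_sub_left 1
    refine (hI'.mul_const ((1 - k ^ q) ^ (-(1 / p)))).mono_fun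
      hmeas.aestronglyMeasurable ?_
    rw [EventuallyLE, ae_restrict_iff' measurableSet_uIoc]
    have hne : ∀ᵐ x : ℝ, x ≠ 1 := by simp [ae_iff]
    filter_upwards [hne] with x hx1 hx
    rw [uIoc_of_le zero_le_one] at hx
    have hx' : x < 1 := lt_of_le_of_ne hx.2 hx1
    have habs : |x| = x := abs_of_pos hx.1
    have hle := le_snWeight (k := k) (s := x) hq hk (by rw [habs]; exact hx.2)
    rw [habs] at hle
    have hpos : 0 < (1 - x) * (1 - k ^ q) := mul_pos (by linarith) (by linarith)
    rw [← mul_rpow (by linarith) (by linarith), norm_of_nonneg (rpow_nonneg hpos.le _),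
      norm_of_nonneg (rpow_nonneg (hpos.le.trans hle) _)]
    exact rpow_le_rpow_of_nonpos hpos hle (by linarith)
  have h1 : IntervalIntegrable (fun s => snWeight q k s ^ (-(1 / p))) volume 0 (-1) := by
    have h := h0.comp_sub_left 0
    simpa [snWeight_neg] using h
  exact h1.symm.trans h0

/-- Odd extension of `arcsnPQ`. -/
noncomputable def arcsnOdd (p q k σ : ℝ) : ℝ :=
  ∫ s in (0:ℝ)..σ, snWeight q k s ^ (-(1 / p))

lemma arcsnOdd_of_nonneg (p q k : ℝ) {σ : ℝ} (hσ : 0 ≤ σ) :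
    arcsnOdd p q k σ = arcsnPQ p q k σ := by
  refine intervalIntegral.integral_congr fun s hs => ?_
  rw [uIcc_of_le hσ] at hs
  simp [snWeight, abs_of_nonneg hs.1]

lemma arcsnOdd_neg (p q k σ : ℝ) : arcsnOdd p q k (-σ) = -arcsnOdd p q k σ := by
  have h := intervalIntegral.integral_comp_neg (a := 0) (b := σ)
    (fun s => snWeight q k s ^ (-(1 / p)))
  simp only [snWeight_neg, neg_zero] at h
  rw [arcsnOdd, arcsnOdd, h, intervalIntegral.integral_symm]

lemma hasDerivAt_arcsnOdd {p q k σ : ℝ} (hp : 1 < p) (hq : 1 < q) (hk : k ∈ Ico (0:ℝ) 1)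
    (hσ : σ ∈ Ioo (-1 : ℝ) 1) :
    HasDerivAt (arcsnOdd p q k) (snWeight q k σ ^ (-(1 / p))) σ := by
  have hmeas : Measurable (fun s => snWeight q k s ^ (-(1 / p))) :=
    (continuous_snWeight hq k).measurable.pow_const _
  refine intervalIntegral.integral_hasDerivAt_right ?_
    hmeas.stronglyMeasurable.stronglyMeasurableAtFilter ?_
  · refine (intervalIntegrable_snWeight hp hq hk).mono_set ?_
    rw [uIcc_of_le (by norm_num : (-1:ℝ) ≤ 1)]
    exact uIcc_subset_Icc (by norm_num) (Ioo_subset_Icc_self hσ)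
  · exact (continuous_snWeight hq k).continuousAt.rpow_const
      (Or.inl (snWeight_pos hq hk (abs_lt.2 hσ)).ne')

lemma continuousOn_arcsnOdd {p q k : ℝ} (hp : 1 < p) (hq : 1 < q) (hk : k ∈ Ico (0:ℝ) 1) :
    ContinuousOn (arcsnOdd p q k) (Icc (-1) 1) := by
  have h := intervalIntegral.continuousOn_primitive_interval'
    (intervalIntegrable_snWeight hp hq hk) (a := 0) (by simp)
  rwa [uIcc_of_le (by norm_num : (-1:ℝ) ≤ 1)] at h

lemma strictMonoOn_arcsnOdd {p q k : ℝ} (hp : 1 < p) (hq : 1 < q) (hk : k ∈ Ico (0:ℝ) 1) :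
    StrictMonoOn (arcsnOdd p q k) (Icc (-1) 1) := by
  refine strictMonoOn_of_deriv_pos (convex_Icc _ _) (continuousOn_arcsnOdd hp hq hk) ?_
  intro x hx
  rw [interior_Icc] at hx
  rw [(hasDerivAt_arcsnOdd hp hq hk hx).deriv]
  exact rpow_pos_of_pos (snWeight_pos hq hk (abs_lt.2 hx)) _

lemma image_arcsnOdd {p q k : ℝ} (hp : 1 < p) (hq : 1 < q) (hk : k ∈ Ico (0:ℝ) 1) :
    arcsnOdd p q k '' Icc (-1) 1 = Icc (-Kpq p q k) (Kpq p q k) := by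
  have h1 : arcsnOdd p q k 1 = Kpq p q k := arcsnOdd_of_nonneg p q k zero_le_one
  have hm := (strictMonoOn_arcsnOdd hp hq hk).monotoneOn
  rw [← h1, ← arcsnOdd_neg]
  refine Subset.antisymm (hm.image_Icc_subset) ?_
  exact intermediate_value_Icc (by norm_num) (continuousOn_arcsnOdd hp hq hk)

lemma Kpq_pos {p q k : ℝ} (hp : 1 < p) (hq : 1 < q) (hk : k ∈ Ico (0:ℝ) 1) :
    0 < Kpq p q k := by
  have h := strictMonoOn_arcsnOdd hp hq hk (a := 0) (b := 1) (by simp) (by simp) one_pos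
  rwa [arcsnOdd_of_nonneg p q k le_rfl, arcsnOdd_of_nonneg p q k zero_le_one, arcsnPQ,
    intervalIntegral.integral_same] at h

/-- `sn` inverts `arcsnOdd` on the symmetric interval. -/
lemma sn_arcsnOdd {p q k : ℝ} {sn : ℝ → ℝ}
    (hinv : ∀ σ ∈ Icc (0:ℝ) 1, sn (arcsnPQ p q k σ) = σ) (hodd : ∀ t : ℝ, sn (-t) = - sn t)
    {σ : ℝ} (hσ : σ ∈ Icc (-1 : ℝ) 1) : sn (arcsnOdd p q k σ) = σ := by
  rcases le_total 0 σ with h | h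
  · rw [arcsnOdd_of_nonneg p q k h, hinv σ ⟨h, hσ.2⟩]
  · have h' : 0 ≤ -σ := by linarith
    have h2 := hinv (-σ) ⟨h', by linarith [hσ.1]⟩
    rw [← arcsnOdd_of_nonneg p q k h', arcsnOdd_neg, hodd] at h2
    linarith

lemma strictMonoOn_sn {p q k : ℝ} (hp : 1 < p) (hq : 1 < q) (hk : k ∈ Ico (0:ℝ) 1)
    {sn : ℝ → ℝ} (hsn : ∀ σ ∈ Icc (-1 : ℝ) 1, sn (arcsnOdd p q k σ) = σ) :
    StrictMonoOn sn (Icc (-Kpq p q k) (Kpq p q k)) := by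
  rw [← image_arcsnOdd hp hq hk]
  rintro _ ⟨x, hx, rfl⟩ _ ⟨y, hy, rfl⟩ hxy
  rw [hsn x hx, hsn y hy]
  exact ((strictMonoOn_arcsnOdd hp hq hk).lt_iff_lt hx hy).1 hxy

lemma image_sn {p q k : ℝ} (hp : 1 < p) (hq : 1 < q) (hk : k ∈ Ico (0:ℝ) 1)
    {sn : ℝ → ℝ} (hsn : ∀ σ ∈ Icc (-1 : ℝ) 1, sn (arcsnOdd p q k σ) = σ) :
    sn '' Icc (-Kpq p q k) (Kpq p q k) = Icc (-1) 1 := by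
  rw [← image_arcsnOdd hp hq hk, image_image]
  exact (image_congr hsn).trans (image_id' _)

lemma sn_Kpq {p q k : ℝ} {sn : ℝ → ℝ}
    (hsn : ∀ σ ∈ Icc (-1 : ℝ) 1, sn (arcsnOdd p q k σ) = σ) : sn (Kpq p q k) = 1 := by
  have h := hsn 1 (by simp)
  rwa [arcsnOdd_of_nonneg p q k zero_le_one] at h

lemma arcsnOdd_sn {p q k : ℝ} (hp : 1 < p) (hq : 1 < q) (hk : k ∈ Ico (0:ℝ) 1)
    {sn : ℝ → ℝ} (hsn : ∀ σ ∈ Icc (-1 : ℝ) 1, sn (arcsnOdd p q k σ) = σ) {t : ℝ}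
    (ht : t ∈ Icc (-Kpq p q k) (Kpq p q k)) : arcsnOdd p q k (sn t) = t := by
  rw [← image_arcsnOdd hp hq hk] at ht
  obtain ⟨x, hx, rfl⟩ := ht
  rw [hsn x hx]

lemma sn_mem_Ioo {p q k : ℝ} (hp : 1 < p) (hq : 1 < q) (hk : k ∈ Ico (0:ℝ) 1)
    {sn : ℝ → ℝ} (hsn : ∀ σ ∈ Icc (-1 : ℝ) 1, sn (arcsnOdd p q k σ) = σ) {t : ℝ}
    (ht : t ∈ Ioo (-Kpq p q k) (Kpq p q k)) : sn t ∈ Ioo (-1 : ℝ) 1 := by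
  have hK := Kpq_pos hp hq hk
  have hm := strictMonoOn_sn hp hq hk hsn
  have hK1 := sn_Kpq hsn
  have hK2 : sn (-Kpq p q k) = -1 := by
    have h := hsn (-1) (by simp)
    rwa [arcsnOdd_neg, arcsnOdd_of_nonneg p q k zero_le_one] at h
  exact ⟨hK2.symm.trans_lt (hm (by simp [hK.le]) (Ioo_subset_Icc_self ht) ht.1),
    (hm (Ioo_subset_Icc_self ht) (by simp [hK.le]) ht.2).trans_eq hK1⟩

lemma hasDerivAt_sn_of_mem_Ioo {p q k : ℝ} (hp : 1 < p) (hq : 1 < q) (hk : k ∈ Ico (0:ℝ) 1)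
    {sn : ℝ → ℝ} (hsn : ∀ σ ∈ Icc (-1 : ℝ) 1, sn (arcsnOdd p q k σ) = σ) {t : ℝ}
    (ht : t ∈ Ioo (-Kpq p q k) (Kpq p q k)) :
    HasDerivAt sn (snWeight q k (sn t) ^ (1 / p)) t := by
  have hst := sn_mem_Ioo hp hq hk hsn ht
  have hpos := snWeight_pos hq hk (abs_lt.2 hst)
  have hnhds : Icc (-Kpq p q k) (Kpq p q k) ∈ 𝓝 t := Icc_mem_nhds ht.1 ht.2
  have hc : ContinuousAt sn t := by
    refine (strictMonoOn_sn hp hq hk hsn).continuousAt_of_image_mem_nhds hnhds ?_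
    rw [image_sn hp hq hk hsn]
    exact Icc_mem_nhds hst.1 hst.2
  refine (HasDerivAt.of_local_left_inverse hc (hasDerivAt_arcsnOdd hp hq hk hst)
    (rpow_pos_of_pos hpos _).ne' ?_).congr_deriv ?_
  · filter_upwards [hnhds] with y hy using arcsnOdd_sn hp hq hk hsn hy
  · rw [rpow_neg hpos.le, inv_inv]

/-- The right-hand side of the equation satisfied by `sn`. -/
noncomputable def snForce (p q k s : ℝ) : ℝ :=
  -(q / (p / (p - 1)) * phi q s * (1 + k ^ q - 2 * k ^ q * |s| ^ q))

lemma snForce_neg (p q k s : ℝ) : snForce p q k (-s) = -snForce p q k s := by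
  simp [snForce, phi_neg]

lemma continuous_snForce {q : ℝ} (hq : 1 < q) (p k : ℝ) : Continuous (snForce p q k) := by
  have h1 := continuous_phi hq
  have h2 : Continuous fun s : ℝ => |s| ^ q :=
    continuous_abs.rpow_const fun _ => Or.inr (by linarith)
  unfold snForce
  fun_prop

lemma hasDerivAt_phi_deriv_sn_of_mem_Ioo {p q k : ℝ} (hp : 1 < p) (hq : 1 < q)
    (hk : k ∈ Ico (0:ℝ) 1) {sn : ℝ → ℝ}
    (hsn : ∀ σ ∈ Icc (-1 : ℝ) 1, sn (arcsnOdd p q k σ) = σ) {t : ℝ}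
    (ht : t ∈ Ioo (-Kpq p q k) (Kpq p q k)) :
    HasDerivAt (fun s => phi p (deriv sn s)) (snForce p q k (sn t)) t := by
  have hp0 : p ≠ 0 := by positivity
  have hp1 : p - 1 ≠ 0 := by linarith
  have hpos : ∀ y ∈ Ioo (-Kpq p q k) (Kpq p q k), 0 < snWeight q k (sn y) := fun y hy =>
    snWeight_pos hq hk (abs_lt.2 (sn_mem_Ioo hp hq hk hsn hy))
  have heq : (fun s => phi p (deriv sn s)) =ᶠ[𝓝 t]
      fun s => snWeight q k (sn s) ^ ((p - 1) / p) := by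
    filter_upwards [Ioo_mem_nhds ht.1 ht.2] with y hy
    rw [(hasDerivAt_sn_of_mem_Ioo hp hq hk hsn hy).deriv,
      phi_of_pos p (rpow_pos_of_pos (hpos y hy) _), ← rpow_mul (hpos y hy).le]
    congr 1
    ring
  have hd := ((hasDerivAt_snWeight hq k (sn t)).comp t
    (hasDerivAt_sn_of_mem_Ioo hp hq hk hsn ht)).rpow_const (p := (p - 1) / p)
      (Or.inl (hpos t ht).ne')
  refine (hd.congr_of_eventuallyEq heq).congr_deriv ?_
  have hexp : snWeight q k (sn t) ^ (1 / p) * snWeight q k (sn t) ^ ((p - 1) / p - 1) = 1 := by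
    rw [← rpow_add (hpos t ht)]
    have : 1 / p + ((p - 1) / p - 1) = 0 := by field_simp; ring
    rw [this, rpow_zero]
  simp only [Function.comp_apply]
  calc _ = -(q * phi q (sn t) * (1 + k ^ q - 2 * k ^ q * |sn t| ^ q)) * ((p - 1) / p) *
        (snWeight q k (sn t) ^ (1 / p) * snWeight q k (sn t) ^ ((p - 1) / p - 1)) := by ring
    _ = _ := by
        rw [hexp, snForce]
        field_simp

lemma continuousAt_sn_Kpq {p q k : ℝ} (hp : 1 < p) (hq : 1 < q)
    (hk : k ∈ Ico (0:ℝ) 1) {sn : ℝ → ℝ}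
    (hsn : ∀ σ ∈ Icc (-1 : ℝ) 1, sn (arcsnOdd p q k σ) = σ)
    (hsymm : ∀ t, sn (2 * Kpq p q k - t) = sn t) : ContinuousAt sn (Kpq p q k) := by
  have hK := Kpq_pos hp hq hk
  have hL : ContinuousWithinAt sn (Iic (Kpq p q k)) (Kpq p q k) := by
    refine (strictMonoOn_sn hp hq hk hsn).continuousWithinAt_left_of_image_mem_nhdsWithin
      (Icc_mem_nhdsLE (by linarith)) ?_
    rw [image_sn hp hq hk hsn, sn_Kpq hsn]
    exact Icc_mem_nhdsLE (by norm_num)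
  have hR : ContinuousWithinAt sn (Ici (Kpq p q k)) (Kpq p q k) := by
    have hr : ContinuousWithinAt (fun t => 2 * Kpq p q k - t) (Ici (Kpq p q k)) (Kpq p q k) := by
      fun_prop
    have hv : 2 * Kpq p q k - Kpq p q k = Kpq p q k := by ring
    have hcomp := ContinuousWithinAt.comp (g := sn) (t := Iic (Kpq p q k)) (by rwa [hv]) hr
      (fun t (ht : Kpq p q k ≤ t) => by simp only [mem_Iic]; linarith)
    exact hcomp.congr (fun t _ => (hsymm t).symm) (hsymm _).symm
  exact continuousAt_iff_continuous_left_right.2 ⟨hL, hR⟩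

lemma deriv_sn_reflect {K : ℝ} {sn : ℝ → ℝ} (hsymm : ∀ t, sn (2 * K - t) = sn t) (t : ℝ) :
    deriv sn (2 * K - t) = -deriv sn t := by
  have h := deriv_comp_const_sub (f := sn) (a := 2 * K) (x := t)
  rw [funext hsymm] at h
  linarith

/-- A function with the reflection symmetry of `sn` that satisfies a reflection-invariant local
property on `(-K, K)` satisfies it near `K`, except possibly at `K`. -/
lemma eventually_nhdsNE_of_reflect {K : ℝ} (hK : 0 < K) {P : ℝ → Prop}
    (h : ∀ t ∈ Ioo (-K) K, P t) (hP : ∀ t, P (2 * K - t) → P t) : ∀ᶠ t in 𝓝[≠] K, P t := by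
  filter_upwards [self_mem_nhdsWithin,
    mem_nhdsWithin_of_mem_nhds (Ioo_mem_nhds (a := -K) (b := 3 * K) (by linarith) (by linarith))]
    with t hne ht
  rcases lt_or_gt_of_ne hne with h1 | h1
  · exact h t ⟨ht.1, h1⟩
  · exact hP t (h _ ⟨by linarith [ht.2], by linarith⟩)

lemma hasDerivAt_phi_reflect {K p e : ℝ} {sn : ℝ → ℝ}
    (hsymm : ∀ t, sn (2 * K - t) = sn t) {t : ℝ}
    (h : HasDerivAt (fun s => phi p (deriv sn s)) e (2 * K - t)) :
    HasDerivAt (fun s => phi p (deriv sn s)) e t := by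
  have h2 := (h.comp_const_sub (2 * K) t).neg
  rw [neg_neg] at h2
  have hf : (-fun s => phi p (deriv sn (2 * K - s))) = fun s => phi p (deriv sn s) := by
    funext s
    simp [deriv_sn_reflect hsymm, phi_neg]
  rwa [hf] at h2

lemma hasDerivAt_sn_Kpq {p q k : ℝ} (hp : 1 < p) (hq : 1 < q)
    (hk : k ∈ Ico (0:ℝ) 1) {sn : ℝ → ℝ}
    (hsn : ∀ σ ∈ Icc (-1 : ℝ) 1, sn (arcsnOdd p q k σ) = σ)
    (hsymm : ∀ t, sn (2 * Kpq p q k - t) = sn t) :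
    HasDerivAt sn 0 (Kpq p q k) ∧
      HasDerivAt (fun s => phi p (deriv sn s)) (snForce p q k (sn (Kpq p q k))) (Kpq p q k) := by
  have hK := Kpq_pos hp hq hk
  have hp0 : 0 < 1 / p := by positivity
  have hc := continuousAt_sn_Kpq hp hq hk hsn hsymm
  have hW1 : snWeight q k (sn (Kpq p q k)) = 0 := by simp [snWeight, sn_Kpq hsn]
  have hdiff : ∀ᶠ t in 𝓝[≠] (Kpq p q k), DifferentiableAt ℝ sn t := by
    refine eventually_nhdsNE_of_reflect hK
      (fun t ht => (hasDerivAt_sn_of_mem_Ioo hp hq hk hsn ht).differentiableAt) fun t ht => ?_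
    rw [← differentiableAt_comp_const_sub] at ht
    rwa [funext hsymm] at ht
  have habs : ∀ᶠ t in 𝓝[≠] (Kpq p q k), snWeight q k (sn t) ^ (1 / p) = |deriv sn t| := by
    refine eventually_nhdsNE_of_reflect hK (fun t ht => ?_) fun t ht => ?_
    · rw [(hasDerivAt_sn_of_mem_Ioo hp hq hk hsn ht).deriv, abs_of_nonneg]
      exact rpow_nonneg
        (snWeight_pos hq hk (abs_lt.2 (sn_mem_Ioo hp hq hk hsn ht))).le _
    · rwa [hsymm, deriv_sn_reflect hsymm, abs_neg] at ht
  have hlim : Tendsto (deriv sn) (𝓝[≠] (Kpq p q k)) (𝓝 0) := by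
    rw [tendsto_zero_iff_abs_tendsto_zero]
    refine Tendsto.congr' habs ?_
    have h : ContinuousAt (fun t => snWeight q k (sn t) ^ (1 / p)) (Kpq p q k) :=
      ((continuous_snWeight hq k).continuousAt.comp hc).rpow_const (Or.inr hp0.le)
    have h2 := h.tendsto
    simp only [hW1, zero_rpow hp0.ne'] at h2
    exact h2.mono_left nhdsWithin_le_nhds
  have hder := hasDerivAt_of_tendsto_deriv_nhdsNE hdiff hc hlim
  refine ⟨hder, ?_⟩
  have hphi : ∀ᶠ t in 𝓝[≠] (Kpq p q k),
      HasDerivAt (fun s => phi p (deriv sn s)) (snForce p q k (sn t)) t := by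
    refine eventually_nhdsNE_of_reflect hK
      (fun t ht => hasDerivAt_phi_deriv_sn_of_mem_Ioo hp hq hk hsn ht) fun t ht => ?_
    rw [hsymm] at ht
    exact hasDerivAt_phi_reflect hsymm ht
  have hcd : ContinuousAt (deriv sn) (Kpq p q k) := by
    rw [continuousAt_iff_punctured_nhds, hder.deriv]
    exact hlim
  refine hasDerivAt_of_tendsto_deriv_nhdsNE (hphi.mono fun t ht => ht.differentiableAt)
    ((continuous_phi hp).continuousAt.comp hcd) ?_
  refine Tendsto.congr' (hphi.mono fun t ht => ht.deriv.symm) ?_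
  exact ((continuous_snForce hq p k).continuousAt.comp hc).tendsto.mono_left nhdsWithin_le_nhds

lemma sn_reflect {K : ℝ} {sn : ℝ → ℝ}
    (hrefl : ∀ t ∈ Icc K (2 * K), sn t = sn (2 * K - t))
    (hodd : ∀ t : ℝ, sn (-t) = - sn t) (hper : ∀ t : ℝ, sn (t + 4 * K) = sn t) (hK : 0 < K)
    (t : ℝ) : sn (2 * K - t) = sn t := by
  have h1 : ∀ t ∈ Icc 0 (2 * K), sn (2 * K - t) = sn t := fun t ht => by
    rcases le_total K t with h | h
    · exact (hrefl t ⟨h, ht.2⟩).symm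
    · rw [hrefl (2 * K - t) ⟨by linarith, by linarith [ht.1]⟩, sub_sub_cancel]
  have h2 : ∀ t ∈ Icc (-(2 * K)) (2 * K), sn (2 * K - t) = sn t := fun t ht => by
    rcases le_total 0 t with h | h
    · exact h1 t ⟨h, ht.2⟩
    · have h3 := h1 (-t) ⟨by linarith, by linarith [ht.1]⟩
      have h4 := hper (-2 * K - t)
      have h5 := hodd (2 * K - -t)
      rw [hodd] at h3
      rw [show -2 * K - t + 4 * K = 2 * K - t by ring] at h4
      rw [show -(2 * K - -t) = -2 * K - t by ring] at h5
      linarith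
  have hP : Function.Periodic sn (4 * K) := hper
  obtain ⟨n, hn, -⟩ := existsUnique_add_zsmul_mem_Ioc (show 0 < 4 * K by linarith) t (-(2 * K))
  have h6 := h2 _ ⟨hn.1.le, by linarith [hn.2]⟩
  rw [← sub_sub, hP.sub_zsmul_eq, (hP.zsmul n) t] at h6
  exact h6

theorem stmt9 (p q k : ℝ) (hp : 1 < p) (hq : 1 < q) (hk : k ∈ Ico (0:ℝ) 1)
    (sn : ℝ → ℝ)
    (hinv : ∀ σ ∈ Icc (0:ℝ) 1, sn (arcsnPQ p q k σ) = σ)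
    (hrefl : ∀ t ∈ Icc (Kpq p q k) (2 * Kpq p q k), sn t = sn (2 * Kpq p q k - t))
    (hodd : ∀ t : ℝ, sn (-t) = - sn t)
    (hper : ∀ t : ℝ, sn (t + 4 * Kpq p q k) = sn t) :
    ∃ u' : ℝ → ℝ, (∀ t : ℝ, HasDerivAt sn (u' t) t) ∧
      ∀ t : ℝ, HasDerivAt (fun s => phi p (u' s))
        (-(q / (p / (p - 1)) * phi q (sn t) * (1 + k ^ q - 2 * k ^ q * |sn t| ^ q))) t := by
  have hK := Kpq_pos hp hq hk
  have hsn : ∀ σ ∈ Icc (-1 : ℝ) 1, sn (arcsnOdd p q k σ) = σ := fun σ hσ =>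
    sn_arcsnOdd hinv hodd hσ
  have hsymm := sn_reflect hrefl hodd hper hK
  have hanti : Function.Antiperiodic sn (2 * Kpq p q k) := fun t => by
    rw [← hsymm, ← hodd]
    congr 1
    ring
  have hderiv_anti : Function.Antiperiodic (deriv sn) (2 * Kpq p q k) := fun t => by
    rw [← deriv_comp_add_const, funext hanti, deriv.fun_neg]
  let D : ℝ → Prop := fun t => DifferentiableAt ℝ sn t ∧
    HasDerivAt (fun s => phi p (deriv sn s)) (snForce p q k (sn t)) t
  have hD : Function.Periodic D (2 * Kpq p q k) := fun t => by
    have e1 : DifferentiableAt ℝ sn (t + 2 * Kpq p q k) ↔ DifferentiableAt ℝ sn t := by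
      rw [← differentiableAt_comp_add_const, funext hanti, differentiableAt_fun_neg_iff]
    have e2 : (HasDerivAt (fun s => phi p (deriv sn s)) (snForce p q k (sn (t + 2 * Kpq p q k)))
        (t + 2 * Kpq p q k)) ↔
        HasDerivAt (fun s => phi p (deriv sn s)) (snForce p q k (sn t)) t := by
      have hf : (fun s => phi p (deriv sn (s + 2 * Kpq p q k))) =
          -fun s => phi p (deriv sn s) := by
        funext s
        simp [hderiv_anti s, phi_neg]
      rw [hanti t, snForce_neg]
      constructor
      · intro h
        have h2 := h.comp_add_const t (2 * Kpq p q k)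
        rw [hf] at h2
        simpa using h2.neg
      · intro h
        have h2 := h.neg
        rw [← hf] at h2
        rw [← add_sub_cancel_right t (2 * Kpq p q k)] at h2
        have h3 := h2.comp_sub_const (t + 2 * Kpq p q k) (2 * Kpq p q k)
        have hs : (fun s => phi p (deriv sn (s - 2 * Kpq p q k + 2 * Kpq p q k))) =
            fun s => phi p (deriv sn s) := by
          simp only [sub_add_cancel]
        rw [hs, add_sub_cancel_right] at h3
        exact h3
    exact propext (and_congr e1 e2)
  have hall : ∀ t, D t := fun t => by
    obtain ⟨n, hn, -⟩ := existsUnique_add_zsmul_mem_Ioc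
      (show 0 < 2 * Kpq p q k by linarith) t (-Kpq p q k)
    rw [← hD.zsmul n t]
    rcases eq_or_lt_of_le hn.2 with h | h
    · rw [h, show -Kpq p q k + 2 * Kpq p q k = Kpq p q k by ring]
      have hends := hasDerivAt_sn_Kpq hp hq hk hsn hsymm
      exact ⟨hends.1.differentiableAt, hends.2⟩
    · have hmem : t + n • (2 * Kpq p q k) ∈ Ioo (-Kpq p q k) (Kpq p q k) :=
        ⟨hn.1, by linarith⟩
      exact ⟨(hasDerivAt_sn_of_mem_Ioo hp hq hk hsn hmem).differentiableAt,
        hasDerivAt_phi_deriv_sn_of_mem_Ioo hp hq hk hsn hmem⟩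
  exact ⟨deriv sn, fun t => (hall t).1.hasDerivAt, fun t => (hall t).2⟩
end
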